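/- Consider all simplicial complexes K on the 4-element set [4] = {1,2,3,4} with K ≠ 2^{[4]} whose Bier sphere Bier(K) is a flag complex (every minimal non-face of Bier(K) has at most 2 elements). Then, up to combinatorial equivalence (bijections of the 8-element ground sets [4] ⊔ [4]' mapping faces to faces in both directions), these flag Bier spheres fall into exactly 4 equivalence classes. -/

import Mathlib

/-- A simplicial complex on a ground type `V`: a collection of finite subsets of `V`
containing the empty set and closed under taking subsets. -/
def IsSimplicialComplex {V : Type*} (K : Set (Finset V)) : Prop :=
  ∅ ∈ K ∧ ∀ s ∈ K, ∀ t ⊆ s, t ∈ K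

/-- A minimal non-face of `K`: not a face, but all proper subsets are faces. -/
def IsMinNonFace {V : Type*} (K : Set (Finset V)) (s : Finset V) : Prop :=
  s ∉ K ∧ ∀ t ⊂ s, t ∈ K

/-- The Alexander dual of `K`, with the primed copy `V'` identified with `V`:
faces are those `τ` with `V \ τ` not a face of `K`. -/
def alexDual {V : Type*} [Fintype V] [DecidableEq V] (K : Set (Finset V)) :
    Set (Finset V) :=
  {τ | Finset.univ \ τ ∉ K}

/-- The Bier sphere of `K`: the deleted join of `K` and its Alexander dual, a complex on
`V ⊕ V` (left summand = `V`, right summand = the primed copy `V'`). -/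
def bier {V : Type*} [Fintype V] [DecidableEq V] (K : Set (Finset V)) :
    Set (Finset (V ⊕ V)) :=
  {ρ | ∃ σ τ : Finset V, σ ∈ K ∧ τ ∈ alexDual K ∧ Disjoint σ τ ∧
    ρ = σ.image Sum.inl ∪ τ.image Sum.inr}

/-- A flag simplicial complex: every minimal non-face has at most two elements. -/
def IsFlag {V : Type*} (K : Set (Finset V)) : Prop :=
  ∀ s : Finset V, IsMinNonFace K s → s.card ≤ 2

/-- Combinatorial equivalence of two simplicial complexes on the same ground type:
a bijection of the ground sets mapping faces to faces in both directions. -/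
def CombEquiv {α : Type*} [DecidableEq α] (L₁ L₂ : Set (Finset α)) : Prop :=
  ∃ e : α ≃ α, ∀ s : Finset α, s ∈ L₁ ↔ s.image e ∈ L₂

section BierSpheres

variable {V : Type*} [Fintype V] [DecidableEq V]

theorem mem_bier {K : Set (Finset V)} {ρ : Finset (V ⊕ V)} :
    ρ ∈ bier K ↔ ρ.toLeft ∈ K ∧ ρ.toRight ∈ alexDual K ∧ Disjoint ρ.toLeft ρ.toRight := by
  constructor
  · rintro ⟨σ, τ, hσ, hτ, hd, rfl⟩
    have h₁ : (σ.image Sum.inl ∪ τ.image Sum.inr : Finset (V ⊕ V)).toLeft = σ := by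
      ext; simp
    have h₂ : (σ.image Sum.inl ∪ τ.image Sum.inr : Finset (V ⊕ V)).toRight = τ := by
      ext; simp
    rw [h₁, h₂]
    exact ⟨hσ, hτ, hd⟩
  · rintro ⟨hσ, hτ, hd⟩
    refine ⟨_, _, hσ, hτ, hd, ?_⟩
    ext (x | x) <;> simp

instance (K : Set (Finset V)) [DecidablePred (· ∈ K)] : DecidablePred (· ∈ alexDual K) :=
  fun τ => inferInstanceAs (Decidable (¬ (Finset.univ \ τ ∈ K)))

instance (K : Set (Finset V)) [DecidablePred (· ∈ K)] : DecidablePred (· ∈ bier K) :=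
  fun _ => decidable_of_iff' _ mem_bier

theorem IsSimplicialComplex.alexDual {K : Set (Finset V)} (hK : IsSimplicialComplex K)
    (hne : K ≠ Set.univ) : IsSimplicialComplex (alexDual K) :=
  ⟨fun h => hne (Set.eq_univ_of_forall fun s => hK.2 _ h s (by simp)),
    fun _ hs _ ht h => hs (hK.2 _ h _ (Finset.sdiff_subset_sdiff subset_rfl ht))⟩

theorem IsSimplicialComplex.bier {K : Set (Finset V)} (hK : IsSimplicialComplex K)
    (hne : K ≠ Set.univ) : IsSimplicialComplex (bier K) := by
  have hK' := hK.alexDual hne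
  refine ⟨⟨∅, ∅, hK.1, hK'.1, by simp, by simp⟩, fun s hs t ht => ?_⟩
  obtain ⟨h₁, h₂, h₃⟩ := mem_bier.1 hs
  have hl := Finset.toLeft_subset_toLeft ht
  have hr := Finset.toRight_subset_toRight ht
  exact mem_bier.2 ⟨hK.2 _ h₁ _ hl, hK'.2 _ h₂ _ hr, h₃.mono hl hr⟩

/-- A complex is flag if and only if it contains every set all of whose pairs are faces. -/
theorem isFlag_iff {L : Set (Finset V)} (hL : IsSimplicialComplex L) :
    IsFlag L ↔ ∀ s : Finset V, (∀ x ∈ s, ∀ y ∈ s, {x, y} ∈ L) → s ∈ L := by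
  refine ⟨fun h s hs => ?_, fun h s ⟨hs, hmin⟩ => ?_⟩
  · by_contra hsL
    obtain ⟨t, hts, ht⟩ := (Set.toFinite {t : Finset V | t ∉ L}).exists_le_minimal hsL
    have htmin : IsMinNonFace L t :=
      ⟨ht.prop, fun u hu => by_contra fun huL => hu.2 (ht.le_of_le huL hu.1)⟩
    refine ht.prop ?_
    have hcard := h t htmin
    interval_cases h : t.card
    · exact Finset.card_eq_zero.1 h ▸ hL.1
    · obtain ⟨i, rfl⟩ := Finset.card_eq_one.1 h
      simpa using hs i (hts (by simp)) i (hts (by simp))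
    · obtain ⟨i, j, -, rfl⟩ := Finset.card_eq_two.1 h
      exact hs i (hts (by simp)) j (hts (by simp))
  · by_contra! hc
    refine hs (h s fun x hx y hy => hmin _ (Finset.ssubset_iff_subset_ne.2 ⟨?_, ?_⟩))
    · simp [Finset.insert_subset_iff, hx, hy]
    · rintro rfl
      exact absurd Finset.card_le_two hc.not_ge

theorem IsFlag.mem_iff {L : Set (Finset V)} (h : IsFlag L) (hL : IsSimplicialComplex L)
    {s : Finset V} : s ∈ L ↔ ∀ x ∈ s, ∀ y ∈ s, {x, y} ∈ L :=
  ⟨fun hs x hx y hy => hL.2 s hs _ (by simp [Finset.insert_subset_iff, hx, hy]),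
    (isFlag_iff hL).1 h s⟩

/-- The Bier sphere is flag if and only if the complex and its Alexander dual are. -/
theorem isFlag_bier_iff {K : Set (Finset V)} (hK : IsSimplicialComplex K)
    (hne : K ≠ Set.univ) : IsFlag (bier K) ↔ IsFlag K ∧ IsFlag (alexDual K) := by
  have hK' := hK.alexDual hne
  have hl : ∀ x y, {.inl x, .inl y} ∈ bier K ↔ {x, y} ∈ K := fun x y => by
    have h₁ : ({.inl x, .inl y} : Finset (V ⊕ V)).toLeft = {x, y} := by ext; simp
    have h₂ : ({.inl x, .inl y} : Finset (V ⊕ V)).toRight = ∅ := by ext; simp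
    simp [mem_bier, h₁, h₂, hK'.1]
  have hr : ∀ x y, {.inr x, .inr y} ∈ bier K ↔ {x, y} ∈ alexDual K := fun x y => by
    have h₁ : ({.inr x, .inr y} : Finset (V ⊕ V)).toLeft = ∅ := by ext; simp
    have h₂ : ({.inr x, .inr y} : Finset (V ⊕ V)).toRight = {x, y} := by ext; simp
    simp [mem_bier, h₁, h₂, hK.1]
  rw [isFlag_iff (hK.bier hne), isFlag_iff hK, isFlag_iff hK']
  refine ⟨fun h => ⟨fun s hs => ?_, fun s hs => ?_⟩, fun ⟨h₁, h₂⟩ s hs => mem_bier.2 ⟨?_, ?_, ?_⟩⟩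
  · have := (mem_bier.1 (h (s.disjSum ∅) (by simpa [hl] using hs))).1
    rwa [Finset.toLeft_disjSum] at this
  · have := (mem_bier.1 (h (Finset.disjSum ∅ s) (by simpa [hr] using hs))).2.1
    rwa [Finset.toRight_disjSum] at this
  · exact h₁ _ fun x hx y hy => (hl x y).1
      (hs _ (Finset.mem_toLeft.1 hx) _ (Finset.mem_toLeft.1 hy))
  · exact h₂ _ fun x hx y hy => (hr x y).1
      (hs _ (Finset.mem_toRight.1 hx) _ (Finset.mem_toRight.1 hy))
  · refine Finset.disjoint_left.2 fun x hx hx' => ?_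
    have := (mem_bier.1 (hs _ (Finset.mem_toLeft.1 hx) _ (Finset.mem_toRight.1 hx'))).2.2
    exact Finset.disjoint_left.1 this (show x ∈ _ by simp) (by simp)

/-- If the Alexander dual is flag, then faces of codimension at least three can be extended. -/
theorem exists_insert_mem_of_isFlag_alexDual {K : Set (Finset V)} (hK : IsSimplicialComplex K)
    (hF : IsFlag (alexDual K)) {s : Finset V} (hs : s ∈ K) (hcard : s.card + 2 < Fintype.card V) :
    ∃ j ∉ s, insert j s ∈ K := by
  by_contra! hno
  have := hF (Finset.univ \ s) ⟨fun h => h (by simpa using hs), fun t ht htK => ?_⟩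
  · rw [Finset.card_sdiff_of_subset (by simp), Finset.card_univ] at this
    lia
  · obtain ⟨j, hj, hjt⟩ := Finset.exists_of_ssubset ht
    refine hno j (by simpa using hj) (hK.2 _ htK _ fun x hx => ?_)
    rcases Finset.mem_insert.1 hx with rfl | hx
    · simpa using hjt
    · simpa using fun h => (Finset.mem_sdiff.1 (ht.1 h)).2 hx

theorem combEquiv_bier_of_perm {K L : Set (Finset V)} (π : V ≃ V)
    (h : ∀ s, s ∈ K ↔ s.image π ∈ L) : CombEquiv (bier K) (bier L) := by
  refine ⟨Equiv.sumCongr π π, fun s => ?_⟩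
  have hl : (s.image (Equiv.sumCongr π π)).toLeft = s.toLeft.image π := by ext; simp
  have hr : (s.image (Equiv.sumCongr π π)).toRight = s.toRight.image π := by ext; simp
  have hc : Finset.univ \ s.toRight.image π = (Finset.univ \ s.toRight).image π := by
    rw [Finset.image_sdiff _ _ π.injective, Finset.image_univ_equiv]
  rw [mem_bier, mem_bier, hl, hr, Finset.disjoint_image π.injective, ← h]
  simp only [alexDual, Set.mem_ofPred_eq, hc, ← h]

end BierSpheres

theorem CombEquiv.trans {α : Type*} [DecidableEq α] {L₁ L₂ L₃ : Set (Finset α)}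
    (h₁ : CombEquiv L₁ L₂) (h₂ : CombEquiv L₂ L₃) : CombEquiv L₁ L₃ := by
  obtain ⟨e, he⟩ := h₁
  obtain ⟨f, hf⟩ := h₂
  refine ⟨e.trans f, fun s => ?_⟩
  rw [he, hf, Finset.image_image]
  rfl

/-- For flag complexes a combinatorial equivalence only has to be checked on pairs. -/
theorem combEquiv_of_isFlag {α : Type*} [Fintype α] [DecidableEq α] {L₁ L₂ : Set (Finset α)}
    (h₁ : IsSimplicialComplex L₁) (h₂ : IsSimplicialComplex L₂) (hF₁ : IsFlag L₁)
    (hF₂ : IsFlag L₂) (e : α ≃ α) (h : ∀ x y, {x, y} ∈ L₁ ↔ {e x, e y} ∈ L₂) :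
    CombEquiv L₁ L₂ := by
  refine ⟨e, fun s => ?_⟩
  rw [hF₁.mem_iff h₁, hF₂.mem_iff h₂]
  simp [h]

/-- The sum over all vertices `v` of the squared number of `w` such that `{v, w}` is a face. -/
def sumSqDegree {α : Type*} [Fintype α] [DecidableEq α] (L : Set (Finset α))
    [DecidablePred (· ∈ L)] : ℕ :=
  ∑ v : α, (Finset.univ.filter fun w => {v, w} ∈ L).card ^ 2

theorem CombEquiv.sumSqDegree_eq {α : Type*} [Fintype α] [DecidableEq α]
    {L₁ L₂ : Set (Finset α)} [DecidablePred (· ∈ L₁)] [DecidablePred (· ∈ L₂)]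
    (h : CombEquiv L₁ L₂) : sumSqDegree L₁ = sumSqDegree L₂ := by
  obtain ⟨e, he⟩ := h
  refine Fintype.sum_equiv e _ _ fun v => ?_
  congr 1
  refine Finset.card_equiv e fun w => ?_
  simp [he {v, w}, Finset.image_insert]

section EdgeComplex

variable {V : Type*}

/-- The faces are the cliques of `G` which consist of non-isolated vertices. -/
def edgeComplex (G : SimpleGraph V) : Set (Finset V) :=
  {s | (∀ i ∈ s, ∀ j ∈ s, i ≠ j → G.Adj i j) ∧ ∀ i ∈ s, ∃ j, G.Adj i j}

instance [Fintype V] [DecidableEq V] (G : SimpleGraph V) [DecidableRel G.Adj] :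
    DecidablePred (· ∈ edgeComplex G) := fun s =>
  inferInstanceAs (Decidable
    ((∀ i ∈ s, ∀ j ∈ s, i ≠ j → G.Adj i j) ∧ ∀ i ∈ s, ∃ j, G.Adj i j))

theorem isSimplicialComplex_edgeComplex (G : SimpleGraph V) :
    IsSimplicialComplex (edgeComplex G) :=
  ⟨⟨by simp, by simp⟩, fun _ hs _ ht => ⟨fun i hi j hj => hs.1 i (ht hi) j (ht hj),
    fun i hi => hs.2 i (ht hi)⟩⟩

theorem pair_mem_edgeComplex [DecidableEq V] {G : SimpleGraph V} {i j : V} (h : G.Adj i j) :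
    {i, j} ∈ edgeComplex G := by
  refine ⟨?_, ?_⟩
  · simp [h, h.symm]
  · simpa using ⟨⟨j, h⟩, ⟨i, h.symm⟩⟩

theorem edgeComplex_ne_univ [Fintype V] {G : SimpleGraph V} (hG : G ≠ ⊤) :
    edgeComplex G ≠ Set.univ := by
  intro h
  have hu : Finset.univ ∈ edgeComplex G := h ▸ Set.mem_univ _
  refine hG (top_unique fun i j hij => ?_)
  exact hu.1 i (by simp) j (by simp) hij

theorem isFlag_edgeComplex [Fintype V] [DecidableEq V] (G : SimpleGraph V) :
    IsFlag (edgeComplex G) := by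
  refine (isFlag_iff (isSimplicialComplex_edgeComplex G)).2 fun s hs => ⟨fun i hi j hj => ?_,
    fun i hi => ?_⟩
  · exact (hs i hi j hj).1 i (by simp) j (by simp)
  · exact (hs i hi i hi).2 i (by simp)

theorem isFlag_alexDual_edgeComplex [Fintype V] [DecidableEq V] (hV : Fintype.card V = 4)
    {G : SimpleGraph V} (hG : G ≠ ⊥) : IsFlag (alexDual (edgeComplex G)) := by
  intro τ ⟨hτ, hmin⟩
  by_contra! hc
  replace hτ : Finset.univ \ τ ∈ edgeComplex G := not_not.1 hτ
  have hcard : (Finset.univ \ τ).card ≤ 1 := by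
    rw [Finset.card_sdiff_of_subset (by simp), Finset.card_univ]
    lia
  obtain ⟨i, j, hij, hsub⟩ : ∃ i j, G.Adj i j ∧ Finset.univ \ τ ⊆ {i, j} := by
    rcases Finset.eq_empty_or_nonempty (Finset.univ \ τ) with h | ⟨i, hi⟩
    · obtain ⟨i, j, hij⟩ := SimpleGraph.ne_bot_iff_exists_adj.1 hG
      exact ⟨i, j, hij, by simp [h]⟩
    · obtain ⟨j, hij⟩ := hτ.2 i hi
      refine ⟨i, j, hij, fun x hx => ?_⟩
      simp [Finset.card_le_one.1 hcard x hx i hi]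
  have hlt : Finset.univ \ {i, j} ⊂ τ := by
    refine Finset.ssubset_iff_subset_ne.2 ⟨?_, ?_⟩
    · intro x hx
      by_contra hxτ
      exact (Finset.mem_sdiff.1 hx).2 (hsub (by simpa using hxτ))
    · rintro rfl
      rw [Finset.card_sdiff_of_subset (by simp), Finset.card_univ,
        Finset.card_pair hij.ne] at hc
      lia
  exact hmin _ hlt (by simpa using pair_mem_edgeComplex hij)

theorem mem_edgeComplex_iff_image_mem [DecidableEq V] {G H : SimpleGraph V} (π : V ≃ V)
    (h : ∀ i j, G.Adj i j ↔ H.Adj (π i) (π j)) (s : Finset V) :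
    s ∈ edgeComplex G ↔ s.image π ∈ edgeComplex H := by
  have hex : ∀ i, (∃ j, H.Adj (π i) j) ↔ ∃ j, H.Adj (π i) (π j) := fun i =>
    π.surjective.exists
  simp only [edgeComplex, Set.mem_ofPred_eq, Finset.forall_mem_image, hex, h, π.injective.ne_iff]

/-- The graph of edges of a complex. -/
def edgeGraph [DecidableEq V] (K : Set (Finset V)) : SimpleGraph V where
  Adj i j := i ≠ j ∧ {i, j} ∈ K
  symm := ⟨fun i j h => ⟨h.1.symm, Finset.pair_comm i j ▸ h.2⟩⟩
  loopless := ⟨fun _ h => h.1 rfl⟩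

theorem eq_edgeComplex_edgeGraph [Fintype V] [DecidableEq V] (hV : 3 < Fintype.card V)
    {K : Set (Finset V)} (hK : IsSimplicialComplex K) (hF : IsFlag K)
    (hF' : IsFlag (alexDual K)) : K = edgeComplex (edgeGraph K) := by
  ext s
  refine ⟨fun hs => ⟨fun i hi j hj hij => ⟨hij, ?_⟩, fun i hi => ?_⟩, fun hs => ?_⟩
  · exact (hF.mem_iff hK).1 hs i hi j hj
  · obtain ⟨j, hj, hjK⟩ := exists_insert_mem_of_isFlag_alexDual hK hF' (s := {i})
      (hK.2 s hs _ (by simpa using hi)) (by simpa using hV)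
    exact ⟨j, by simpa [eq_comm] using hj, Finset.pair_comm i j ▸ hjK⟩
  · refine (hF.mem_iff hK).2 fun i hi j hj => ?_
    by_cases hij : i = j
    · obtain ⟨k, hk⟩ := hs.2 i hi
      exact hK.2 _ hk.2 _ (by simp [← hij])
    · exact (hs.1 i hi j hj hij).2

theorem edgeGraph_ne_bot [Fintype V] [DecidableEq V] (hV : 3 < Fintype.card V)
    {K : Set (Finset V)} (hK : IsSimplicialComplex K) (hF' : IsFlag (alexDual K)) :
    edgeGraph K ≠ ⊥ := by
  obtain ⟨i, -, hi⟩ := exists_insert_mem_of_isFlag_alexDual hK hF' hK.1 (by simp; lia)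
  obtain ⟨j, hj, hij⟩ := exists_insert_mem_of_isFlag_alexDual hK hF' hi (by simpa using hV)
  exact SimpleGraph.ne_bot_iff_exists_adj.2 ⟨j, i, by simpa using hj, by simpa using hij⟩

theorem edgeGraph_ne_top [Fintype V] [DecidableEq V] [Nontrivial V]
    {K : Set (Finset V)} (hK : IsSimplicialComplex K) (hne : K ≠ Set.univ) (hF : IsFlag K) :
    edgeGraph K ≠ ⊤ := by
  intro h
  have hpair : ∀ i j, i ≠ j → {i, j} ∈ K := fun i j hij =>
    ((by rw [h]; exact hij) : (edgeGraph K).Adj i j).2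
  refine hne (Set.eq_univ_of_forall fun s => (hF.mem_iff hK).2 fun i _ j _ => ?_)
  by_cases hij : i = j
  · obtain ⟨k, hk⟩ := exists_ne i
    exact hK.2 _ (hpair i k hk.symm) _ (by simp [← hij])
  · exact hpair i j hij

end EdgeComplex

/-- The graph on four vertices with a given list of edges. -/
def listGraph (l : List (Fin 4 × Fin 4)) : SimpleGraph (Fin 4) :=
  SimpleGraph.fromRel fun i j => (i, j) ∈ l

instance (l : List (Fin 4 × Fin 4)) : DecidableRel (listGraph l).Adj := fun i j =>
  inferInstanceAs (Decidable (i ≠ j ∧ ((i, j) ∈ l ∨ (j, i) ∈ l)))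

/-- The pairs `(i, j)` with `i < j` in `Fin 4`. -/
def fourPairs : List (Fin 4 × Fin 4) := [(0, 1), (0, 2), (0, 3), (1, 2), (1, 3), (2, 3)]

theorem exists_eq_listGraph (G : SimpleGraph (Fin 4)) :
    ∃ l ∈ fourPairs.sublists, G = listGraph l := by
  classical
  refine ⟨fourPairs.filter fun p => G.Adj p.1 p.2,
    List.mem_sublists.2 List.filter_sublist, ?_⟩
  ext i j
  have h : i ≠ j ↔ (i, j) ∈ fourPairs ∨ (j, i) ∈ fourPairs := by
    revert i j
    decide
  rw [listGraph, SimpleGraph.fromRel_adj]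
  simp only [List.mem_filter, decide_eq_true_eq, G.adj_comm j i, ← or_and_right, ← h]
  exact ⟨fun hG => ⟨hG.ne, hG.ne, hG⟩, fun hG => hG.2.2⟩

/-- The edge, the path with two edges, the star and the path with three edges: one graph for each
combinatorial type of flag Bier sphere. -/
def bierGraph : Fin 4 → List (Fin 4 × Fin 4) :=
  ![[(0, 1)], [(0, 1), (1, 2)], [(0, 1), (0, 2), (0, 3)], [(0, 1), (1, 2), (2, 3)]]

/-- The isomorphism types of graphs on four vertices which are neither empty nor complete, each
with the index of the combinatorial type of its Bier sphere and a bijection onto that sphere. -/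
def graphTypes : List (List (Fin 4 × Fin 4) × Fin 4 × (Fin 4 ⊕ Fin 4 ≃ Fin 4 ⊕ Fin 4)) :=
  [(bierGraph 0, 0, .refl _),
    (bierGraph 1, 1, .refl _),
    (bierGraph 2, 2, .refl _),
    (bierGraph 3, 3, .refl _),
    ([(0, 1), (0, 2), (1, 2)], 0, .swap (.inl 2) (.inr 3)),
    ([(0, 1), (2, 3)], 3,
      ((Equiv.swap (.inl 1) (.inr 3)).trans (.swap (.inl 2) (.inr 0))).trans
        (.swap (.inr 1) (.inr 2))),
    ([(0, 3), (0, 1), (1, 3), (1, 2)], 1, .swap (.inl 3) (.inr 2)),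
    ([(0, 1), (1, 2), (2, 3), (0, 3)], 3,
      ((Equiv.swap (.inl 0) (.inr 1)).trans (.swap (.inl 1) (.inl 2))).trans
        (.swap (.inl 3) (.inr 2))),
    ([(0, 1), (0, 2), (1, 2), (0, 3), (1, 3)], 0,
      (Equiv.swap (.inl 2) (.inr 2)).trans (.swap (.inl 3) (.inr 3)))]

theorem isFlag_bier_edgeComplex {G : SimpleGraph (Fin 4)} (h₀ : G ≠ ⊥) (h₁ : G ≠ ⊤) :
    IsFlag (bier (edgeComplex G)) :=
  (isFlag_bier_iff (isSimplicialComplex_edgeComplex G) (edgeComplex_ne_univ h₁)).2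
    ⟨isFlag_edgeComplex G, isFlag_alexDual_edgeComplex (by simp) h₀⟩

theorem listGraph_ne_bot_and_ne_top_of_mem_graphTypes :
    ∀ r ∈ graphTypes, listGraph r.1 ≠ ⊥ ∧ listGraph r.1 ≠ ⊤ := by
  have h : ∀ r ∈ graphTypes, (∃ i j, (listGraph r.1).Adj i j) ∧
      ∃ i j, i ≠ j ∧ ¬ (listGraph r.1).Adj i j := by
    decide +kernel
  intro r hr
  obtain ⟨h₀, i, j, hij, hn⟩ := h r hr
  exact ⟨SimpleGraph.ne_bot_iff_exists_adj.2 h₀, fun he => hn (by rw [he]; exact hij)⟩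

theorem bierGraph_mem_graphTypes (j : Fin 4) :
    (bierGraph j, j, .refl _) ∈ graphTypes := by
  fin_cases j <;> simp [graphTypes]

theorem combEquiv_of_mem_graphTypes {r} (hr : r ∈ graphTypes) :
    CombEquiv (bier (edgeComplex (listGraph r.1)))
      (bier (edgeComplex (listGraph (bierGraph r.2.1)))) := by
  have h : ∀ r ∈ graphTypes, ∀ x y, {x, y} ∈ bier (edgeComplex (listGraph r.1)) ↔
      {r.2.2 x, r.2.2 y} ∈ bier (edgeComplex (listGraph (bierGraph r.2.1))) := by
    decide +kernel
  obtain ⟨h₀, h₁⟩ := listGraph_ne_bot_and_ne_top_of_mem_graphTypes r hr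
  obtain ⟨h₀', h₁'⟩ :=
    listGraph_ne_bot_and_ne_top_of_mem_graphTypes _ (bierGraph_mem_graphTypes r.2.1)
  exact combEquiv_of_isFlag
    ((isSimplicialComplex_edgeComplex _).bier (edgeComplex_ne_univ h₁))
    ((isSimplicialComplex_edgeComplex _).bier (edgeComplex_ne_univ h₁'))
    (isFlag_bier_edgeComplex h₀ h₁) (isFlag_bier_edgeComplex h₀' h₁') r.2.2 (h r hr)

theorem exists_mem_graphTypes_of_mem_sublists : ∀ l ∈ fourPairs.sublists,
    l ≠ [] → l ≠ fourPairs → ∃ r ∈ graphTypes, r.1.length = l.length ∧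
    ∃ a b c : Fin 4, ∀ i j, (listGraph l).Adj i j ↔ (listGraph r.1).Adj
      (((Equiv.swap 0 a).trans (.swap 1 b)).trans (.swap 2 c) i)
      (((Equiv.swap 0 a).trans (.swap 1 b)).trans (.swap 2 c) j) := by
  decide +kernel

/-- Every graph on four vertices which is neither empty nor complete is isomorphic to one of the
listed graphs. -/
theorem exists_mem_graphTypes {G : SimpleGraph (Fin 4)} (h₀ : G ≠ ⊥) (h₁ : G ≠ ⊤) :
    ∃ r ∈ graphTypes, ∃ π : Fin 4 ≃ Fin 4,
      ∀ i j, G.Adj i j ↔ (listGraph r.1).Adj (π i) (π j) := by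
  obtain ⟨l, hl, rfl⟩ := exists_eq_listGraph G
  obtain ⟨r, hr, -, a, b, c, h⟩ := exists_mem_graphTypes_of_mem_sublists l hl
    (by
      rintro rfl
      refine h₀ (bot_unique fun i j hij => ?_)
      simp [listGraph] at hij)
    (by
      rintro rfl
      have h : ∀ i j, i ≠ j → (listGraph fourPairs).Adj i j := by decide
      exact h₁ (top_unique h))
  exact ⟨r, hr, _, h⟩

theorem eq_of_sumSqDegree_eq : ∀ j k : Fin 4,
    sumSqDegree (bier (edgeComplex (listGraph (bierGraph j)))) =
      sumSqDegree (bier (edgeComplex (listGraph (bierGraph k)))) → j = k := by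
  have h : ∀ j, sumSqDegree (bier (edgeComplex (listGraph (bierGraph j)))) =
      ![150, 197, 248, 244] j := by
    decide +kernel
  intro j k
  rw [h, h]
  revert j k
  decide

/-- the flag Bier spheres of simplicial complexes on `[4]` (other than
the full simplex) fall into exactly 4 combinatorial equivalence classes. -/
theorem flag_bier_spheres_on_four_vertices_four_classes :
    ∃ Ks : Fin 4 → Set (Finset (Fin 4)),
      (∀ j, IsSimplicialComplex (Ks j) ∧ Ks j ≠ Set.univ ∧ IsFlag (bier (Ks j))) ∧
      (∀ j k, CombEquiv (bier (Ks j)) (bier (Ks k)) → j = k) ∧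
      (∀ K : Set (Finset (Fin 4)), IsSimplicialComplex K → K ≠ Set.univ →
        IsFlag (bier K) → ∃ j, CombEquiv (bier K) (bier (Ks j))) := by
  refine ⟨fun j => edgeComplex (listGraph (bierGraph j)), fun j => ?_, fun j k h =>
    eq_of_sumSqDegree_eq j k h.sumSqDegree_eq, fun K hK hne hF => ?_⟩
  · obtain ⟨h₀, h₁⟩ :=
      listGraph_ne_bot_and_ne_top_of_mem_graphTypes _ (bierGraph_mem_graphTypes j)
    exact ⟨isSimplicialComplex_edgeComplex _, edgeComplex_ne_univ h₁,
      isFlag_bier_edgeComplex h₀ h₁⟩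
  · obtain ⟨hF, hF'⟩ := (isFlag_bier_iff hK hne).1 hF
    obtain ⟨r, hr, π, hπ⟩ := exists_mem_graphTypes (edgeGraph_ne_bot (by simp) hK hF')
      (edgeGraph_ne_top hK hne hF)
    refine ⟨r.2.1, CombEquiv.trans ?_ (combEquiv_of_mem_graphTypes hr)⟩
    rw [eq_edgeComplex_edgeGraph (by simp) hK hF hF']
    exact combEquiv_bier_of_perm π (mem_edgeComplex_iff_image_mem π hπ)
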